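/- arXiv:2603.01904 — 5 statements merged into one kernel-verified Lean document; each statement's English description precedes it below -/
import Mathlib

section
/- Let n' ≥ 2 and q ≥ 2 be integers with gcd(n', q) = 1, set m' = ord_{n'}(q) and Δ = (q^{m'} − 1)/n' (an integer since n' divides q^{m'} − 1), and let r be a prime dividing n'. Then ord_{r·n'}(q) = r·m' if r does not divide Δ, and ord_{r·n'}(q) = m' if r divides Δ. (Lemma 4.3(2), lem_ordqn part (2).) -/
/-- The multiplicative order of `q` modulo `N`: the least positive integer `i`
such that `N` divides `q ^ i - 1`. -/
noncomputable def multOrd (q N : ℕ) : ℕ := sInf {i : ℕ | 0 < i ∧ N ∣ q ^ i - 1}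

theorem dvd_pow_sub_one_iff_natCast_pow_eq_one {q : ℕ} (hq : 0 < q) (N i : ℕ) :
    N ∣ q ^ i - 1 ↔ (q : ZMod N) ^ i = 1 := by
  rw [← ZMod.natCast_eq_zero_iff, Nat.cast_sub (Nat.one_le_pow _ _ hq), sub_eq_zero]
  simp

theorem multOrd_eq_orderOf {q N : ℕ} (hq : 0 < q) (hN : 0 < N) (hco : Nat.Coprime q N) :
    multOrd q N = orderOf (q : ZMod N) := by
  have : NeZero N := ⟨hN.ne'⟩
  have hfin : IsOfFinOrder (q : ZMod N) := by
    rw [← ZMod.coe_unitOfCoprime q hco, Units.isOfFinOrder_val]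
    exact isOfFinOrder_of_finite _
  have hmem : orderOf (q : ZMod N) ∈ {i : ℕ | 0 < i ∧ N ∣ q ^ i - 1} :=
    ⟨hfin.orderOf_pos,
      (dvd_pow_sub_one_iff_natCast_pow_eq_one hq N _).2 (pow_orderOf_eq_one _)⟩
  refine le_antisymm (Nat.sInf_le hmem) (le_csInf ⟨_, hmem⟩ ?_)
  rintro i ⟨hi, hdvd⟩
  exact orderOf_le_of_pow_eq_one hi ((dvd_pow_sub_one_iff_natCast_pow_eq_one hq N i).1 hdvd)

theorem dvd_pow_sub_one_iff_multOrd_dvd {q N : ℕ} (hq : 0 < q) (hN : 0 < N)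
    (hco : Nat.Coprime q N) (i : ℕ) : N ∣ q ^ i - 1 ↔ multOrd q N ∣ i := by
  rw [multOrd_eq_orderOf hq hN hco, dvd_pow_sub_one_iff_natCast_pow_eq_one hq,
    orderOf_dvd_iff_pow_eq_one]

theorem exists_one_add_pow_eq (x k : ℕ) : ∃ c, (1 + x) ^ k = 1 + k * x + c * x ^ 2 := by
  induction k with
  | zero => exact ⟨0, by simp⟩
  | succ k ih =>
    obtain ⟨c, hc⟩ := ih
    exact ⟨k + c + c * x, by rw [pow_succ, hc]; ring⟩

/-- If `r ∣ n`, raising `1 + n * Δ` to the power `k` multiplies `Δ` by `k` modulo `r`. -/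
theorem mul_dvd_one_add_pow_sub_one_iff {r n : ℕ} (hn : 0 < n) (hrn : r ∣ n) (Δ k : ℕ) :
    r * n ∣ (1 + n * Δ) ^ k - 1 ↔ r ∣ k * Δ := by
  obtain ⟨c, hc⟩ := exists_one_add_pow_eq (n * Δ) k
  have h : (1 + n * Δ) ^ k - 1 = (k * Δ + n * (c * Δ ^ 2)) * n := by
    rw [hc, add_assoc, Nat.add_sub_cancel_left]
    ring
  rw [h, Nat.mul_dvd_mul_iff_right hn]
  exact (Nat.dvd_add_iff_left (hrn.mul_right _)).symm

/-- Lemma 4.3(2), lem_ordqn(2): let `m' = ord_{n'}(q)` and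
`Δ = (q ^ m' - 1) / n'`, and let `r` be a prime dividing `n'`. Then
`ord_{r·n'}(q) = r · m'` if `r ∤ Δ`, and `ord_{r·n'}(q) = m'` if `r ∣ Δ`. -/
theorem stmt5 (q n' : ℕ) (hn' : 2 ≤ n') (hq : 2 ≤ q) (hco : Nat.gcd n' q = 1)
    (r : ℕ) (hr : r.Prime) (hrq : Nat.gcd r q = 1) (hrn : r ∣ n')
    (m' Δ : ℕ) (hm' : m' = multOrd q n') (hΔ : Δ = (q ^ m' - 1) / n') :
    (¬ r ∣ Δ → multOrd q (r * n') = r * m') ∧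
      (r ∣ Δ → multOrd q (r * n') = m') := by
  have hq0 : 0 < q := by omega
  have hn0 : 0 < n' := by omega
  have hcon : Nat.Coprime q n' := Nat.Coprime.symm hco
  have hcorn : Nat.Coprime q (r * n') := Nat.Coprime.mul_right (Nat.Coprime.symm hrq) hcon
  have hord := dvd_pow_sub_one_iff_multOrd_dvd hq0 hn0 hcon
  have hord' := dvd_pow_sub_one_iff_multOrd_dvd hq0 (Nat.mul_pos hr.pos hn0) hcorn
  rw [← hm'] at hord
  have hpow : q ^ m' = 1 + n' * Δ := by
    have h1 : n' * Δ = q ^ m' - 1 := by rw [hΔ, Nat.mul_div_cancel' ((hord m').2 dvd_rfl)]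
    have h2 : 1 ≤ q ^ m' := Nat.one_le_pow _ _ hq0
    omega
  have key (k : ℕ) : multOrd q (r * n') ∣ m' * k ↔ r ∣ k * Δ := by
    rw [← hord', pow_mul, hpow, mul_dvd_one_add_pow_sub_one_iff hn0 hrn]
  have hm_dvd : m' ∣ multOrd q (r * n') :=
    (hord _).1 ((Dvd.intro_left r rfl).trans ((hord' _).2 dvd_rfl))
  constructor
  · intro hnd
    obtain ⟨k, hk⟩ := hm_dvd
    have hrk : r ∣ k := (hr.dvd_mul.1 ((key k).1 hk.dvd)).resolve_right hnd
    rw [mul_comm r m']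
    refine Nat.dvd_antisymm ((key r).2 (Dvd.intro _ rfl)) ?_
    rw [hk]
    exact Nat.mul_dvd_mul_left m' hrk
  · intro hd
    refine Nat.dvd_antisymm ?_ hm_dvd
    simpa using (key 1).2 (by simpa using hd)
end

section
/- Let q ≥ 2 be an integer and let m₁, m₂ be coprime positive integers. Then gcd(q^{m₁·m₂} − 1, (q^{m₁} − 1)·(q^{m₂} − 1)) = (q^{m₁} − 1)·(q^{m₂} − 1)/(q − 1) = lcm(q^{m₁} − 1, q^{m₂} − 1); equivalently, (q − 1) · gcd(q^{m₁·m₂} − 1, (q^{m₁} − 1)·(q^{m₂} − 1)) = (q^{m₁} − 1)·(q^{m₂} − 1). (Claim proven inside Proposition 5.10, prop_C4.) -/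
theorem Nat.dvd_of_dvd_geom_sum {d x m : ℕ} (hx : x ≡ 1 [MOD d])
    (h : d ∣ ∑ i ∈ Finset.range m, x ^ i) : d ∣ m := by
  have hsum : (∑ i ∈ Finset.range m, (x : ZMod d) ^ i) = m := by
    have hx' : (x : ZMod d) = 1 := by
      simpa using (ZMod.natCast_eq_natCast_iff x 1 d).mpr hx
    simp [hx']
  rw [← ZMod.natCast_eq_zero_iff] at h ⊢
  rw [← hsum]
  exact_mod_cast h

/-- A common divisor of `q - 1` and of the cofactor of `q ^ m - 1` in `q ^ (m * n) - 1`
divides `n`. -/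
theorem Nat.dvd_of_dvd_pow_mul_sub_one_cofactor {q m n c d : ℕ} (hq : 2 ≤ q) (hm : 0 < m)
    (hc : q ^ (m * n) - 1 = (q ^ m - 1) * c) (hdc : d ∣ c) (hdq : d ∣ q - 1) : d ∣ n := by
  have hqm : 2 ≤ q ^ m := hq.trans (Nat.le_self_pow hm.ne' q)
  have hsum : c = ∑ i ∈ Finset.range n, (q ^ m) ^ i := by
    rw [Nat.geomSum_eq hqm, ← pow_mul, hc, Nat.mul_div_cancel_left _ (by omega)]
  have hq1 : q ≡ 1 [MOD d] := ((Nat.modEq_iff_dvd' (by omega)).mpr hdq).symm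
  exact Nat.dvd_of_dvd_geom_sum (by simpa using hq1.pow m) (hsum ▸ hdc)

/-- claim inside Proposition 5.10, prop_C4: for coprime positive
integers `m₁, m₂` and `q ≥ 2`,
`gcd(q^{m₁m₂} - 1, (q^{m₁} - 1)(q^{m₂} - 1)) = (q^{m₁} - 1)(q^{m₂} - 1)/(q - 1)
 = lcm(q^{m₁} - 1, q^{m₂} - 1)`. -/
theorem stmt11 (q m₁ m₂ : ℕ) (hq : 2 ≤ q) (h₁ : 0 < m₁) (h₂ : 0 < m₂)
    (hco : Nat.gcd m₁ m₂ = 1) :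
    (q - 1) * Nat.gcd (q ^ (m₁ * m₂) - 1) ((q ^ m₁ - 1) * (q ^ m₂ - 1)) =
        (q ^ m₁ - 1) * (q ^ m₂ - 1) ∧
      Nat.gcd (q ^ (m₁ * m₂) - 1) ((q ^ m₁ - 1) * (q ^ m₂ - 1)) =
        Nat.lcm (q ^ m₁ - 1) (q ^ m₂ - 1) := by
  have hgcd : Nat.gcd (q ^ m₁ - 1) (q ^ m₂ - 1) = q - 1 := by
    rw [Nat.pow_sub_one_gcd_pow_sub_one, hco, pow_one]
  have hmul := Nat.gcd_mul_lcm (q ^ m₁ - 1) (q ^ m₂ - 1)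
  rw [hgcd] at hmul
  suffices h : Nat.gcd (q ^ (m₁ * m₂) - 1) ((q ^ m₁ - 1) * (q ^ m₂ - 1)) =
      Nat.lcm (q ^ m₁ - 1) (q ^ m₂ - 1) from ⟨by rw [h, hmul], h⟩
  obtain ⟨k, hk⟩ : Nat.lcm (q ^ m₁ - 1) (q ^ m₂ - 1) ∣ q ^ (m₁ * m₂) - 1 :=
    Nat.lcm_dvd (Nat.pow_sub_one_dvd_pow_sub_one q (dvd_mul_right m₁ m₂))
      (Nat.pow_sub_one_dvd_pow_sub_one q (dvd_mul_left m₂ m₁))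
  obtain ⟨u, hu⟩ := Nat.dvd_lcm_left (q ^ m₁ - 1) (q ^ m₂ - 1)
  obtain ⟨v, hv⟩ := Nat.dvd_lcm_right (q ^ m₁ - 1) (q ^ m₂ - 1)
  have hcop : Nat.gcd k (q - 1) = 1 := by
    have hg₂ : Nat.gcd k (q - 1) ∣ m₂ :=
      Nat.dvd_of_dvd_pow_mul_sub_one_cofactor hq h₁ (c := u * k)
        (by rw [hk, hu, mul_assoc]) ((Nat.gcd_dvd_left _ _).mul_left u) (Nat.gcd_dvd_right _ _)
    have hg₁ : Nat.gcd k (q - 1) ∣ m₁ :=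
      Nat.dvd_of_dvd_pow_mul_sub_one_cofactor hq h₂ (c := v * k)
        (by rw [mul_comm m₂, hk, hv, mul_assoc]) ((Nat.gcd_dvd_left _ _).mul_left v)
        (Nat.gcd_dvd_right _ _)
    exact Nat.eq_one_of_dvd_coprimes hco hg₁ hg₂
  rw [hk, ← hmul, mul_comm (q - 1), Nat.gcd_mul_left, hcop, mul_one]
end

section
/- Let p be a prime, q = p^f a power of p, and let n, n', r be positive integers with n = n'·r, r ≥ 2, gcd(n, q) = 1, and ord_n(q) = r · ord_{n'}(q). Set m = ord_n(q) and m₀ = ord_{n'}(q). Let E be a finite field of characteristic p with |E| = q^m, and let ξ ∈ E have multiplicative order n. For α ∈ E let w(α) = #{i : 0 ≤ i < n, Σ_{j=0}^{m−1} (α·ξ^i)^{q^j} ≠ 0}, and for λ ∈ E with λ^{q^{m₀}} = λ let w₀(λ) = #{i : 0 ≤ i < n', Σ_{j=0}^{m₀−1} (λ·ξ^{r·i})^{q^j} ≠ 0}. Then the set of nonzero values of w, namely {w(α) : α ∈ E} \ {0}, has exactly two elements if and only if r = 2 and the set {w₀(λ) : λ ∈ E, λ^{q^{m₀}} = λ}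 \ {0} has exactly one element. Moreover, if {w(α) : α ∈ E} \ {0} has exactly two elements, then gcd((q^m − 1)/n, (q^m − 1)/(q − 1)) divides q^{m₀} + 1. (Lemma 6.3, lem_TwoweightC2: C(q, m, u) is a two-weight code if and only if C(q, m₀, u₀) is a one-weight code and r = 2, and in that case C(q, m, u) is semiprimitive.) -/
section CyclicCode

open Finset

lemma multOrd_spec {q N : ℕ} (hq : 0 < q) (h : Nat.Coprime q N) (hN : 0 < N) :
    0 < multOrd q N ∧ N ∣ q ^ multOrd q N - 1 :=
  Nat.sInf_mem (s := {i : ℕ | 0 < i ∧ N ∣ q ^ i - 1})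
    ⟨N.totient, Nat.totient_pos.2 hN, (Nat.modEq_iff_dvd' (Nat.pow_pos hq)).1
      (Nat.ModEq.pow_totient h).symm⟩

lemma multOrd_le {q N i : ℕ} (hi : 0 < i) (h : N ∣ q ^ i - 1) : multOrd q N ≤ i :=
  Nat.sInf_le ⟨hi, h⟩

lemma sum_range_mul_eq {M : Type*} [AddCommMonoid M] (F : ℕ → M) (a b : ℕ) :
    ∑ i ∈ range (a * b), F i = ∑ j ∈ range a, ∑ s ∈ range b, F (b * j + s) := by
  induction a with
  | zero => simp
  | succ a ih => rw [Nat.succ_mul, sum_range_add, ih, sum_range_succ, mul_comm a b]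

/-- The sum of the first `s` iterates of `x ↦ x ^ b`; for suitable `b`, `s` and `x` this is a
trace between finite fields. -/
def powTrace {E : Type*} [Field E] (b s : ℕ) (x : E) : E := ∑ j ∈ range s, x ^ b ^ j

variable {E : Type*} [Field E]

lemma powTrace_mul_left {b s : ℕ} {c : E} (hc : c ^ b = c) (x : E) :
    powTrace b s (c * x) = c * powTrace b s x := by
  have h : ∀ j, c ^ b ^ j = c := fun j => by
    induction j with
    | zero => simp
    | succ j ih => rw [pow_succ, pow_mul, ih, hc]
  simp only [powTrace, mul_pow, h, mul_sum]

lemma powTrace_zero {b s : ℕ} (hb : b ≠ 0) : powTrace b s (0 : E) = 0 := by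
  simp [powTrace, hb]

section Char

variable {p : ℕ} [Fact p.Prime] [CharP E p]

lemma powTrace_sub (f s : ℕ) (x y : E) :
    powTrace (p ^ f) s (x - y) = powTrace (p ^ f) s x - powTrace (p ^ f) s y := by
  simp only [powTrace, ← pow_mul, sub_pow_char_pow, sum_sub_distrib]

lemma powTrace_powTrace (f s r : ℕ) (x : E) :
    powTrace (p ^ f) s (powTrace ((p ^ f) ^ s) r x) = powTrace (p ^ f) (r * s) x := by
  simp only [powTrace]
  rw [sum_range_mul_eq, sum_comm]
  refine sum_congr rfl fun j _ => ?_
  rw [← pow_mul p f j, sum_pow_char_pow]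
  refine sum_congr rfl fun k _ => ?_
  rw [← pow_mul x]
  congr 1
  ring

lemma powTrace_pow (f s : ℕ) {x : E} (hx : x ^ (p ^ f) ^ s = x) :
    (powTrace (p ^ f) s x) ^ p ^ f = powTrace (p ^ f) s x := by
  simp only [powTrace]
  rw [sum_pow_char_pow]
  have h := (sum_range_succ (fun j => x ^ (p ^ f) ^ j) s).symm.trans
    (sum_range_succ' (fun j => x ^ (p ^ f) ^ j) s)
  simp only [hx, pow_zero, pow_one] at h
  rw [add_right_cancel h]
  simp only [← pow_mul, pow_succ]

end Char

lemma pow_pow_injective {ζ : E} {b s : ℕ} (hb : Nat.Coprime b (orderOf ζ)) (hb0 : 0 < b)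
    (hζ : ζ ≠ 0) (hs : ∀ i, 0 < i → i < s → ¬ orderOf ζ ∣ b ^ i - 1) :
    Function.Injective fun j : Fin s => ζ ^ b ^ (j : ℕ) := by
  suffices H : ∀ i j : ℕ, i < j → j < s → ζ ^ b ^ i ≠ ζ ^ b ^ j by
    rintro ⟨i, hi⟩ ⟨j, hj⟩ h
    rcases lt_trichotomy i j with hij | hij | hij
    · exact absurd h (H i j hij hj)
    · exact Fin.ext hij
    · exact absurd h.symm (H j i hij hi)
  intro i j hij hj h
  refine hs (j - i) (by omega) (by omega) ?_
  have h1 : orderOf ζ ∣ b ^ j - b ^ i := by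
    refine orderOf_dvd_of_pow_eq_one (mul_left_cancel₀ (pow_ne_zero (b ^ i) hζ) ?_)
    rw [← pow_add, Nat.add_sub_cancel' (Nat.pow_le_pow_right hb0 hij.le), mul_one, h]
  have h2 : b ^ j - b ^ i = b ^ i * (b ^ (j - i) - 1) := by
    rw [Nat.mul_sub, ← pow_add, Nat.add_sub_cancel' hij.le, mul_one]
  rw [h2] at h1
  exact (Nat.Coprime.pow_left i hb).symm.dvd_of_dvd_mul_left h1

lemma eq_zero_of_powTrace_eq_zero {ζ α : E} {b s : ℕ} (hs : 0 < s)
    (hinj : Function.Injective fun j : Fin s => ζ ^ b ^ (j : ℕ))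
    (h : ∀ i < s, powTrace b s (α * ζ ^ i) = 0) : α = 0 := by
  have := Matrix.eq_zero_of_forall_pow_sum_mul_pow_eq_zero
    (v := fun j : Fin s => α ^ b ^ (j : ℕ)) hinj fun i => by
      have := h i i.2
      rw [powTrace, ← Fin.sum_univ_eq_sum_range (fun j => (α * ζ ^ (i : ℕ)) ^ b ^ j)] at this
      rw [← this]
      refine sum_congr rfl fun j _ => ?_
      rw [mul_pow, ← pow_mul, ← pow_mul, mul_comm (i : ℕ)]
  simpa using congrFun this ⟨0, hs⟩

section Card

variable [Fintype E] [DecidableEq E]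

open Polynomial in
lemma card_powTrace_eq_le {b : ℕ} (hb : 2 ≤ b) (t : ℕ) (c : E) :
    (univ.filter fun x : E => powTrace b (t + 1) x = c).card ≤ b ^ t := by
  have hdeg : (∑ j ∈ range t, (X : E[X]) ^ b ^ j - C c).degree < (b ^ t : ℕ) := by
    refine (degree_sub_le _ _).trans_lt (max_lt ?_ ?_)
    · refine (degree_sum_le _ _).trans_lt ((Finset.sup_lt_iff (WithBot.bot_lt_coe _)).2 ?_)
      intro j hj
      rw [degree_X_pow]
      exact_mod_cast Nat.pow_lt_pow_right (by omega) (mem_range.1 hj)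
    · refine degree_C_le.trans_lt ?_
      exact_mod_cast Nat.pow_pos (by omega)
  have hmon := monic_X_pow_add hdeg
  have hnat : (X ^ b ^ t + (∑ j ∈ range t, (X : E[X]) ^ b ^ j - C c)).natDegree = b ^ t :=
    natDegree_eq_of_degree_eq_some (by
      rw [degree_add_eq_left_of_degree_lt (by rwa [degree_X_pow]), degree_X_pow])
  rw [← hnat]
  refine card_le_degree_of_subset_roots fun x hx => ?_
  have hx' : powTrace b (t + 1) x = c := by simpa using hx
  rw [mem_roots hmon.ne_zero, IsRoot, ← hx', powTrace, sum_range_succ]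
  simp [eval_finsetSum]

open Polynomial in
lemma card_pow_eq_self_le {b : ℕ} (hb : 2 ≤ b) :
    (univ.filter fun x : E => x ^ b = x).card ≤ b := by
  conv_rhs => rw [← FiniteField.X_pow_card_sub_X_natDegree_eq E (p := b) hb]
  refine card_le_degree_of_subset_roots fun x hx => ?_
  have hx' : x ^ b = x := by simpa using hx
  rw [mem_roots (FiniteField.X_pow_card_sub_X_ne_zero E hb), IsRoot]
  simp [hx']

lemma card_powTrace_eq_zero {p f s : ℕ} [Fact p.Prime] [CharP E p] (hf : 0 < f)
    (hcard : (univ.filter fun x : E => x ^ (p ^ f) ^ (s + 1) = x).card = (p ^ f) ^ (s + 1)) :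
    ((univ.filter fun x : E => x ^ (p ^ f) ^ (s + 1) = x).filter
      fun x => powTrace (p ^ f) (s + 1) x = 0).card = (p ^ f) ^ s := by
  have hq : 2 ≤ p ^ f := (Fact.out : p.Prime).two_le.trans (Nat.le_self_pow hf.ne' p)
  set S := univ.filter fun x : E => x ^ (p ^ f) ^ (s + 1) = x with hS
  set T := univ.filter fun x : E => x ^ p ^ f = x with hT
  have hfib : ∀ c : E, (S.filter fun x => powTrace (p ^ f) (s + 1) x = c).card ≤ (p ^ f) ^ s :=
    fun c => (card_le_card (filter_subset_filter _ (subset_univ S))).trans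
      (card_powTrace_eq_le hq s c)
  have hmaps : ∀ x ∈ S, powTrace (p ^ f) (s + 1) x ∈ T := fun x hx => by
    simpa [hT] using powTrace_pow f (s + 1) (by simpa [hS] using hx)
  have h0 : (0 : E) ∈ T := by simp [hT, show p ≠ 0 by rintro rfl; simp [hf.ne'] at hq]
  have hsum := card_eq_sum_card_fiberwise hmaps
  rw [← add_sum_erase T _ h0, hcard] at hsum
  have hle := sum_le_card_nsmul (T.erase 0) _ _ fun c _ => hfib c
  rw [smul_eq_mul] at hle
  have hT' : (T.erase 0).card ≤ p ^ f - 1 := by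
    rw [card_erase_of_mem h0]
    exact Nat.sub_le_sub_right (card_pow_eq_self_le hq) 1
  have := hle.trans (Nat.mul_le_mul_right _ hT')
  have h1 : (p ^ f) ^ (s + 1) = (p ^ f - 1) * (p ^ f) ^ s + (p ^ f) ^ s := by
    rw [← Nat.succ_mul, Nat.succ_eq_add_one, Nat.sub_add_cancel (by omega), pow_succ, mul_comm]
  have := hfib 0
  omega

end Card

lemma sumset_card_two_iff {r : ℕ} (hr : 2 ≤ r) {V W : Finset ℕ} (h0 : 0 ∈ W)
    (hV : ∀ v, v ∈ V ↔ ∃ c : Fin r → ℕ, (∀ s, c s ∈ W) ∧ v = ∑ s, c s) :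
    (V.erase 0).card = 2 ↔ r = 2 ∧ (W.erase 0).card = 1 := by
  have hadd : ∀ a ∈ W, ∀ b ∈ W, a + b ∈ V := fun a ha b hb => by
    obtain ⟨k, rfl⟩ := Nat.exists_eq_add_of_le' hr
    refine (hV _).2 ⟨Fin.cons a (Fin.cons b 0), ?_, by simp [Fin.sum_univ_succ]⟩
    refine Fin.cases (by simpa) (Fin.cases (by simpa) fun i => by simpa)
  rcases lt_trichotomy (W.erase 0).card 1 with h | h | h
  · have hW : ∀ x ∈ W, x = 0 := fun x hx => by
      by_contra hne
      have := card_pos.2 ⟨x, mem_erase.2 ⟨hne, hx⟩⟩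
      omega
    have : V.erase 0 = ∅ := by
      refine eq_empty_of_forall_notMem fun v hv => ?_
      obtain ⟨hv0, hv⟩ := mem_erase.1 hv
      obtain ⟨c, hc, rfl⟩ := (hV v).1 hv
      exact hv0 (sum_eq_zero fun s _ => hW _ (hc s))
    rw [this, card_empty]
    omega
  · obtain ⟨d, hd⟩ := card_eq_one.1 h
    have hd' : d ≠ 0 ∧ d ∈ W := by
      rw [← mem_erase, hd]
      exact mem_singleton_self d
    have hW : ∀ x ∈ W, x = 0 ∨ x = d := fun x hx => or_iff_not_imp_left.2 fun hne => by
      simpa [hd] using mem_erase.2 ⟨hne, hx⟩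
    have : V.erase 0 = (Icc 1 r).image (· * d) := by
      ext v
      simp only [mem_erase, mem_image, mem_Icc, hV]
      constructor
      · rintro ⟨hv, c, hc, rfl⟩
        have hsum : ∑ s, c s = (univ.filter fun s => c s = d).card * d := by
          rw [← smul_eq_mul, ← sum_const, sum_filter]
          refine sum_congr rfl fun s _ => ?_
          rcases hW _ (hc s) with h | h <;> simp [h]
        refine ⟨_, ⟨Nat.one_le_iff_ne_zero.2 fun h => ?_, ?_⟩, hsum.symm⟩
        · simp [hsum, h] at hv
        · exact (card_le_univ _).trans (by simp)
      · rintro ⟨k, ⟨hk1, hk2⟩, rfl⟩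
        refine ⟨mul_ne_zero (by omega) hd'.1, fun s => if (s : ℕ) < k then d else 0,
          fun s => ?_, ?_⟩
        · dsimp only
          split_ifs
          exacts [hd'.2, h0]
        · rw [Fin.sum_univ_eq_sum_range (fun s => if s < k then d else 0), ← sum_filter,
            sum_const, smul_eq_mul]
          congr 1
          rw [show (range r).filter (· < k) = range k by ext; simp; omega, card_range]
    rw [this, card_image_of_injective _ (mul_left_injective₀ hd'.1), Nat.card_Icc]
    simp [h]
  · obtain ⟨a, ha, b, hb, hab⟩ := one_lt_card.1 h
    rw [mem_erase] at ha hb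
    have : ({a, b, a + b} : Finset ℕ) ⊆ V.erase 0 := by
      intro x hx
      simp only [mem_insert, mem_singleton] at hx
      rcases hx with rfl | rfl | rfl
      · exact mem_erase.2 ⟨ha.1, by simpa using hadd x ha.2 0 h0⟩
      · exact mem_erase.2 ⟨hb.1, by simpa using hadd x hb.2 0 h0⟩
      · exact mem_erase.2 ⟨by omega, hadd a ha.2 b hb.2⟩
    have := card_le_card this
    rw [card_insert_of_notMem (by simp; omega), card_insert_of_notMem (by simp; omega),
      card_singleton] at this
    omega

lemma gcd_eq_one_of_mul_eq {q s n u M d : ℕ} (hq : 2 ≤ q) (hun : n * u = q ^ (s + 1) - 1)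
    (hM : (q - 1) * M = q ^ (s + 1) - 1) (hd : u * d = q ^ s * (q - 1))
    (hg : Nat.gcd n (q - 1) ∣ d) : Nat.gcd u M = 1 := by
  obtain ⟨d', rfl⟩ := hg
  have h1 : u * Nat.gcd n (q - 1) = (q - 1) * Nat.gcd u M := by
    rw [← Nat.gcd_mul_left, ← Nat.gcd_mul_left, mul_comm u n, hun, ← hM, Nat.gcd_comm, mul_comm u]
  have h2 : Nat.gcd u M * d' = q ^ s := by
    refine Nat.eq_of_mul_eq_mul_left (show 0 < q - 1 by omega) ?_
    rw [← mul_assoc, ← h1, mul_assoc, hd, mul_comm]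
  have h3 : Nat.gcd u M ∣ q ^ (s + 1) := (Dvd.intro _ h2).trans (pow_dvd_pow q s.le_succ)
  have h4 : Nat.gcd u M ∣ q ^ (s + 1) - 1 :=
    (Nat.gcd_dvd_right u M).trans (hM ▸ Dvd.intro_left _ rfl)
  have h5 := Nat.dvd_sub h3 h4
  rw [Nat.sub_sub_self (Nat.one_le_pow _ _ (by omega))] at h5
  exact Nat.dvd_one.1 h5

lemma card_filter_range_mul {P : ℕ → Prop} [DecidablePred P] {b : ℕ}
    (hP : ∀ i, P (b + i) ↔ P i) (a : ℕ) :
    ((range (a * b)).filter P).card = a * ((range b).filter P).card := by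
  have h : ∀ j s, P (b * j + s) ↔ P s := fun j s => by
    induction j with
    | zero => simp
    | succ j ih => rw [Nat.mul_succ, add_comm (b * j), add_assoc, hP, ih]
  simp only [card_filter, sum_range_mul_eq, h, sum_const, card_range, smul_eq_mul]

lemma gcd_dvd_card_powTrace_ne_zero [DecidableEq E] {q m : ℕ} (hq : 0 < q) {η : E} (hη : η ≠ 0)
    (lam : E) :
    Nat.gcd (orderOf η) (q - 1) ∣
      ((range (orderOf η)).filter fun i => powTrace q m (lam * η ^ i) ≠ 0).card := by
  obtain ⟨b, hb⟩ := Nat.gcd_dvd_left (orderOf η) (q - 1)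
  obtain ⟨e, he⟩ := Nat.gcd_dvd_right (orderOf η) (q - 1)
  have hpow : (η ^ b) ^ (q - 1) = 1 := by
    rw [he, ← pow_mul, mul_left_comm, ← mul_assoc, ← hb, pow_mul, pow_orderOf_eq_one, one_pow]
  have hfix : (η ^ b) ^ q = η ^ b := by
    conv_lhs => rw [← Nat.sub_add_cancel hq, pow_succ, hpow, one_mul]
  have hP : ∀ i, powTrace q m (lam * η ^ (b + i)) ≠ 0 ↔ powTrace q m (lam * η ^ i) ≠ 0 :=
    fun i => by
      rw [pow_add, mul_left_comm, powTrace_mul_left hfix, mul_ne_zero_iff]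
      simp [hη]
  have h := card_filter_range_mul (P := fun i => powTrace q m (lam * η ^ i) ≠ 0) hP
    (Nat.gcd (orderOf η) (q - 1))
  rw [← hb] at h
  exact h ▸ Dvd.intro _ rfl

lemma sum_card_powTrace_ne_zero [Fintype E] [DecidableEq E] {q Q m : ℕ} {η : E} (hη : η ≠ 0)
    (hQ : η ^ Q = η) (n : ℕ) :
    ∑ lam ∈ univ.filter (fun x : E => x ^ Q = x),
        ((range n).filter fun i => powTrace q m (lam * η ^ i) ≠ 0).card =
      n * ((univ.filter fun x : E => x ^ Q = x).filter fun x => powTrace q m x ≠ 0).card := by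
  simp only [card_filter _ (range n)]
  rw [sum_comm]
  simp only [← card_filter]
  refine (sum_eq_card_nsmul fun i _ => ?_).trans (by rw [card_range, smul_eq_mul])
  have hi : (η ^ i) ^ Q = η ^ i := by rw [← pow_mul, mul_comm, pow_mul, hQ]
  have hi0 : η ^ i ≠ 0 := pow_ne_zero i hη
  refine card_bij' (fun x _ => x * η ^ i) (fun x _ => x * (η ^ i)⁻¹) ?_ ?_ ?_ ?_
  · intro x hx
    simp only [mem_filter, mem_univ, true_and] at hx ⊢
    exact ⟨by rw [mul_pow, hx.1, hi], hx.2⟩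
  · intro x hx
    simp only [mem_filter, mem_univ, true_and] at hx ⊢
    exact ⟨by rw [mul_pow, hx.1, inv_pow, hi], by rw [inv_mul_cancel_right₀ hi0]; exact hx.2⟩
  · intro x _
    exact mul_inv_cancel_right₀ hi0 x
  · intro x _
    exact inv_mul_cancel_right₀ hi0 x

end CyclicCode

/-- Lemma 6.3, lem_TwoweightC2: with `n = n'·r`, `r ≥ 2`,
`ord_n(q) = r·ord_{n'}(q)`, `m = ord_n(q)`, `m₀ = ord_{n'}(q)`, `E` a finite
field of characteristic `p` with `|E| = q^m` and `ξ ∈ E` of multiplicative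
order `n`, the irreducible cyclic code `C(q, m, u)` (with weight function `w`)
has exactly two nonzero weights if and only if `r = 2` and `C(q, m₀, u₀)`
(with weight function `w₀` on the subfield `F_{q^{m₀}}`) has exactly one
nonzero weight; moreover in that case `gcd(u, (q^m - 1)/(q - 1))` divides
`q^{m₀} + 1`, i.e. `C(q, m, u)` is semiprimitive. -/
theorem stmt14 (p f q n n' r m m₀ : ℕ) (hp : p.Prime) (hf : 0 < f)
    (hq : q = p ^ f) (hn : n = n' * r) (hr : 2 ≤ r) (hn' : 0 < n')
    (hco : Nat.gcd n q = 1) (hm : m = multOrd q n) (hm₀ : m₀ = multOrd q n')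
    (hmm : m = r * m₀)
    (E : Type*) [Field E] [Fintype E] [DecidableEq E] (hchar : CharP E p)
    (hcard : Fintype.card E = q ^ m) (ξ : E) (hξ : orderOf ξ = n)
    (w : E → ℕ)
    (hw : ∀ α : E, w α = ((Finset.range n).filter
        (fun i => ∑ j ∈ Finset.range m, (α * ξ ^ i) ^ q ^ j ≠ 0)).card)
    (w₀ : E → ℕ)
    (hw₀ : ∀ lam : E, w₀ lam = ((Finset.range n').filter
        (fun i => ∑ j ∈ Finset.range m₀, (lam * ξ ^ (r * i)) ^ q ^ j ≠ 0)).card) :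
    (((Finset.univ.image w).erase 0).card = 2 ↔
        r = 2 ∧
          ((((Finset.univ.filter (fun x : E => x ^ q ^ m₀ = x)).image w₀).erase
            0).card = 1)) ∧
      (((Finset.univ.image w).erase 0).card = 2 →
        Nat.gcd ((q ^ m - 1) / n) ((q ^ m - 1) / (q - 1)) ∣ q ^ m₀ + 1) := by
  have : Fact p.Prime := ⟨hp⟩
  have hq2 : 2 ≤ q := hq ▸ hp.two_le.trans (Nat.le_self_pow hf.ne' p)
  have hn0 : 0 < n := hn ▸ Nat.mul_pos hn' (by omega)
  have hcoq : Nat.Coprime q n := Nat.Coprime.symm hco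
  have hcoq' : Nat.Coprime q n' := hcoq.coprime_dvd_right (hn ▸ Dvd.intro _ rfl)
  obtain ⟨hm₀pos, hm₀dvd⟩ := hm₀ ▸ multOrd_spec (by omega) hcoq' hn'
  have hmdvd := (hm ▸ multOrd_spec (by omega) hcoq hn0).2
  have hξ0 : ξ ≠ 0 := by
    rintro rfl
    rw [orderOf_zero] at hξ
    omega
  set η := ξ ^ r with hηdef
  have hη0 : η ≠ 0 := pow_ne_zero r hξ0
  have hηord : orderOf η = n' := by
    rw [orderOf_pow_of_dvd (by omega) (by rw [hξ, hn]; exact Dvd.intro_left _ rfl), hξ, hn,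
      Nat.mul_div_cancel _ (by omega)]
  have hQ1 : 1 ≤ q ^ m₀ := Nat.one_le_pow _ _ (by omega)
  have hηQ : η ^ q ^ m₀ = η := by
    have h : η ^ (q ^ m₀ - 1) = 1 := orderOf_dvd_iff_pow_eq_one.1 (hηord ▸ hm₀dvd)
    conv_lhs => rw [← Nat.sub_add_cancel hQ1, pow_succ, h, one_mul]
  have hηinj : Function.Injective fun j : Fin m₀ => η ^ q ^ (j : ℕ) := by
    refine pow_pow_injective (hηord ▸ hcoq') (by omega) hη0 fun i hi him hdvd => ?_
    have := multOrd_le hi (hηord ▸ hdvd)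
    omega
  have hξinj : Function.Injective fun j : Fin r => ξ ^ (q ^ m₀) ^ (j : ℕ) := by
    refine pow_pow_injective (hξ ▸ hcoq.pow_left m₀) (by omega) hξ0 fun i hi hir hdvd => ?_
    rw [hξ, ← pow_mul] at hdvd
    have h := multOrd_le (Nat.mul_pos hm₀pos hi) hdvd
    rw [← hm, hmm, mul_comm r] at h
    exact absurd (Nat.le_of_mul_le_mul_left h hm₀pos) (by omega)
  set S := Finset.univ.filter fun x : E => x ^ q ^ m₀ = x with hS
  have hw' : ∀ α, w α = ((Finset.range n).filter
      fun i => powTrace q m (α * ξ ^ i) ≠ 0).card := hw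
  have hw₀' : ∀ lam, w₀ lam = ((Finset.range n').filter
      fun i => powTrace q m₀ (lam * η ^ i) ≠ 0).card := fun lam => by
    simp only [hw₀, powTrace, hηdef, pow_mul]
  have hTS : ∀ α, powTrace (q ^ m₀) r α ∈ S := fun α => by
    have hα : α ^ (p ^ (f * m₀)) ^ r = α := by
      rw [pow_mul, ← hq, ← pow_mul, mul_comm m₀, ← hmm, ← hcard, FiniteField.pow_card]
    have h := powTrace_pow (f * m₀) r hα
    rw [pow_mul, ← hq] at h
    simpa [hS] using h
  have hA : ∀ α, w α = ∑ s : Fin r, w₀ (powTrace (q ^ m₀) r (α * ξ ^ (s : ℕ))) := fun α => by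
    rw [Fin.sum_univ_eq_sum_range fun s => w₀ (powTrace (q ^ m₀) r (α * ξ ^ s)), hw', hn,
      Finset.card_filter, sum_range_mul_eq, Finset.sum_comm]
    refine Finset.sum_congr rfl fun s _ => ?_
    rw [hw₀', Finset.card_filter]
    refine Finset.sum_congr rfl fun k _ => ?_
    have hk : (η ^ k) ^ q ^ m₀ = η ^ k := by rw [← pow_mul, mul_comm, pow_mul, hηQ]
    have : powTrace q m (α * ξ ^ (r * k + s)) =
        powTrace q m₀ (powTrace (q ^ m₀) r (α * ξ ^ s) * η ^ k) := by
      rw [mul_comm _ (η ^ k), ← powTrace_mul_left hk, hmm, hq, powTrace_powTrace, pow_add,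
        pow_mul, mul_left_comm]
    rw [this]
  let Φ : E → Fin r → S := fun α s => ⟨powTrace (q ^ m₀) r (α * ξ ^ (s : ℕ)), hTS _⟩
  have hΦ : Function.Injective Φ := fun α β h => by
    refine sub_eq_zero.1 (eq_zero_of_powTrace_eq_zero (by omega) hξinj fun i hi => ?_)
    have h1 : powTrace (q ^ m₀) r (α * ξ ^ i) = powTrace (q ^ m₀) r (β * ξ ^ i) :=
      congrArg Subtype.val (congrFun h ⟨i, hi⟩)
    rw [hq, ← pow_mul] at h1 ⊢
    rw [sub_mul, powTrace_sub, h1, sub_self]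
  have hQ2 : 2 ≤ q ^ m₀ := hq2.trans (Nat.le_self_pow hm₀pos.ne' q)
  have hEcard : Fintype.card E = (q ^ m₀) ^ r := by rw [hcard, hmm, mul_comm, pow_mul]
  have hScard : S.card = q ^ m₀ := by
    refine le_antisymm (card_pow_eq_self_le hQ2) ?_
    have h := Fintype.card_le_of_injective Φ hΦ
    rw [hEcard, Fintype.card_fun, Fintype.card_fin, Fintype.card_coe] at h
    exact (Nat.pow_le_pow_iff_left (by omega)).1 h
  have hΦsurj : Function.Surjective Φ := by
    refine ((Fintype.bijective_iff_injective_and_card Φ).2 ⟨hΦ, ?_⟩).2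
    rw [hEcard, Fintype.card_fun, Fintype.card_fin, Fintype.card_coe, hScard]
  have h0S : (0 : E) ∈ S := by simp [hS, show q ≠ 0 by omega]
  have hw0 : w₀ 0 = 0 := by simp [hw₀', powTrace_zero (show q ≠ 0 by omega)]
  have hiff := sumset_card_two_iff hr (V := Finset.univ.image w) (W := S.image w₀)
    (Finset.mem_image.2 ⟨0, h0S, hw0⟩) fun v => by
      simp only [Finset.mem_image, Finset.mem_univ, true_and]
      constructor
      · rintro ⟨α, rfl⟩
        exact ⟨_, fun s => ⟨_, hTS _, rfl⟩, hA α⟩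
      · rintro ⟨c, hc, rfl⟩
        choose x hx hxc using hc
        obtain ⟨α, hα⟩ := hΦsurj fun s => ⟨x s, hx s⟩
        refine ⟨α, (hA α).trans (Finset.sum_congr rfl fun s _ => ?_)⟩
        have h1 : powTrace (q ^ m₀) r (α * ξ ^ (s : ℕ)) = x s :=
          congrArg Subtype.val (congrFun hα s)
        rw [h1, hxc]
  refine ⟨hiff, fun h2 => ?_⟩
  obtain ⟨rfl, hone⟩ := hiff.1 h2
  obtain ⟨d, hd⟩ := Finset.card_eq_one.1 hone
  have hconst : ∀ lam ∈ S.erase 0, w₀ lam = d := fun lam hlam => by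
    obtain ⟨hlam0, hlam⟩ := Finset.mem_erase.1 hlam
    have hne : w₀ lam ≠ 0 := fun h => by
      rw [hw₀', Finset.card_eq_zero, Finset.filter_eq_empty_iff] at h
      refine hlam0 (eq_zero_of_powTrace_eq_zero hm₀pos hηinj fun i _ => ?_)
      rw [← pow_mod_orderOf, hηord]
      exact not_not.1 (h (Finset.mem_range.2 (Nat.mod_lt i hn')))
    exact Finset.mem_singleton.1
      (hd ▸ Finset.mem_erase.2 ⟨hne, Finset.mem_image_of_mem w₀ hlam⟩)
  obtain ⟨s, hs⟩ := Nat.exists_eq_add_of_le' (show 1 ≤ m₀ from hm₀pos)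
  have hker : (S.filter fun x => powTrace q m₀ x = 0).card = q ^ s := by
    have h := hScard
    rw [hS] at h ⊢
    rw [hs, hq] at h ⊢
    exact card_powTrace_eq_zero hf h
  have hnonzero : (S.filter fun x => powTrace q m₀ x ≠ 0).card = q ^ s * (q - 1) := by
    have h := Finset.card_filter_add_card_filter_not (s := S) fun x => powTrace q m₀ x = 0
    rw [hker, hScard, show q ^ m₀ = q ^ s * q by rw [hs, pow_succ]] at h
    rw [Nat.mul_sub, mul_one]
    exact Nat.eq_sub_of_add_eq' h
  obtain ⟨u₀, hu₀⟩ := hm₀dvd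
  obtain ⟨M, hM⟩ : q - 1 ∣ q ^ m₀ - 1 := by simpa using Nat.sub_dvd_pow_sub_pow q 1 m₀
  have hu₀d : u₀ * d = q ^ s * (q - 1) := by
    have h := sum_card_powTrace_ne_zero (q := q) (m := m₀) hη0 hηQ n'
    rw [← hS, hnonzero, Finset.sum_congr rfl fun x _ => (hw₀' x).symm,
      ← Finset.add_sum_erase S _ h0S, hw0, Finset.sum_congr rfl hconst, Finset.sum_const,
      Finset.card_erase_of_mem h0S, hScard, hu₀, smul_eq_mul, zero_add, mul_assoc] at h
    exact Nat.eq_of_mul_eq_mul_left hn' h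
  have hgd : Nat.gcd n' (q - 1) ∣ d := by
    have h1S : (1 : E) ∈ S.erase 0 := by simp [hS]
    rw [← hconst 1 h1S, hw₀', ← hηord]
    exact gcd_dvd_card_powTrace_ne_zero (by omega) hη0 1
  have hgcd : Nat.gcd u₀ M = 1 :=
    gcd_eq_one_of_mul_eq hq2 (hs ▸ hu₀.symm) (hs ▸ hM.symm) hu₀d hgd
  have hfac : q ^ m - 1 = (q ^ m₀ + 1) * (q ^ m₀ - 1) := by
    rw [hmm, mul_comm, pow_mul, ← Nat.sq_sub_sq, one_pow]
  have hM' : (q ^ m - 1) / (q - 1) = (q ^ m₀ + 1) * M := by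
    rw [hfac, hM, mul_left_comm, Nat.mul_div_cancel_left _ (by omega)]
  obtain ⟨u, hu⟩ := hmdvd
  have hu2 : 2 * u = (q ^ m₀ + 1) * u₀ := by
    refine Nat.eq_of_mul_eq_mul_left hn' ?_
    rw [← mul_assoc, ← hn, ← hu, hfac, hu₀, mul_left_comm]
  rw [hM', hu, Nat.mul_div_cancel_left _ hn0]
  have h1 : Nat.gcd u ((q ^ m₀ + 1) * M) ∣ (q ^ m₀ + 1) * u₀ :=
    hu2 ▸ (Nat.gcd_dvd_left _ _).mul_left 2
  have h2 := Nat.dvd_gcd h1 (Nat.gcd_dvd_right _ _)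
  rwa [Nat.gcd_mul_left, hgcd, mul_one] at h2
end

section
/- Let p be a prime, q = p^f a power of p, and let E be a finite field of characteristic p with |E| = q^4. Let γ ∈ E with γ ≠ 0 and γ^q = −γ. Then for every nonzero x ∈ E one has γ·x^{q²+1} + (γ·x^{q²+1})^q = 0 if and only if x^{(q−1)(q²+1)} = 1. Consequently, the set of nonzero zeros of the quadratic form Q(x) = Tr_{F_{q²}/F_q}(γ·x^{q²+1}) on F_{q⁴} equals the multiplicative subgroup U_{n,q} of order n = (q − 1)(q² + 1) of E^*. (The defining identity of Example 3.3, exa_C8, extension ovoid codes.) -/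
theorem mul_add_mul_pow_eq_zero_iff {E : Type*} [Field E] {q m : ℕ} (hq : 1 ≤ q) {γ x : E}
    (hγ : γ ≠ 0) (hγq : γ ^ q = -γ) (hx : x ≠ 0) :
    γ * x ^ m + (γ * x ^ m) ^ q = 0 ↔ x ^ ((q - 1) * m) = 1 := by
  have hpow : (x ^ m) ^ q = x ^ ((q - 1) * m) * x ^ m := by
    rw [← pow_mul, ← pow_add, ← Nat.succ_mul, Nat.succ_eq_add_one, Nat.sub_add_cancel hq,
      Nat.mul_comm]
  have hfactor : γ * x ^ m + (γ * x ^ m) ^ q = γ * x ^ m * (1 - x ^ ((q - 1) * m)) := by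
    rw [mul_pow, hγq, hpow]
    ring
  rw [hfactor, mul_eq_zero, or_iff_right (mul_ne_zero hγ (pow_ne_zero m hx)), sub_eq_zero, eq_comm]

/-- defining identity of Example 3.3, exa_C8, extension ovoid
codes: let `E` be a finite field of characteristic `p` with `|E| = q^4`
(`q = p^f`), and `γ ∈ E` nonzero with `γ^q = -γ`. Then for every nonzero
`x ∈ E`: `γx^{q²+1} + (γx^{q²+1})^q = 0` iff `x^{(q-1)(q²+1)} = 1`.
Consequently the set of nonzero zeros of the quadratic form
`Q(x) = Tr_{F_{q²}/F_q}(γ x^{q²+1})` equals the multiplicative subgroup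
`U_{n,q} = {x : x^n = 1}` of order `n = (q-1)(q²+1)`. -/
theorem stmt16 (p f q : ℕ) (hp : p.Prime) (hf : 0 < f) (hq : q = p ^ f)
    (E : Type*) [Field E] [Fintype E] (hchar : CharP E p)
    (hcard : Fintype.card E = q ^ 4)
    (γ : E) (hγ : γ ≠ 0) (hγq : γ ^ q = -γ) :
    (∀ x : E, x ≠ 0 →
        (γ * x ^ (q ^ 2 + 1) + (γ * x ^ (q ^ 2 + 1)) ^ q = 0 ↔
          x ^ ((q - 1) * (q ^ 2 + 1)) = 1)) ∧
      {x : E | x ≠ 0 ∧ γ * x ^ (q ^ 2 + 1) + (γ * x ^ (q ^ 2 + 1)) ^ q = 0} =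
        {x : E | x ^ ((q - 1) * (q ^ 2 + 1)) = 1} := by
  have hq1 : 1 < q := hq ▸ Nat.one_lt_pow hf.ne' hp.one_lt
  have key := fun x : E ↦ mul_add_mul_pow_eq_zero_iff hq1.le hγ hγq (x := x) (m := q ^ 2 + 1)
  refine ⟨key, ?_⟩
  ext x
  refine ⟨fun h ↦ (key x h.1).1 h.2, fun h ↦ ?_⟩
  have hn : (q - 1) * (q ^ 2 + 1) ≠ 0 := mul_ne_zero (Nat.sub_ne_zero_of_lt hq1) (Nat.succ_ne_zero _)
  have hx : x ≠ 0 := by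
    rintro rfl
    exact zero_ne_one ((zero_pow hn).symm.trans h)
  exact ⟨hx, (key x hx).2 h⟩
end

section
/- Let K be a finite field with q elements and let E be a field extension of K of finite degree m. Let ξ ∈ E be an element of finite multiplicative order n, and suppose n = n'·k with k ≥ 2, n' ≥ 2 and n ≥ 6, that m = ord_n(q), and that m = k·m' where m' = ord_{n'}(q). Then the group of K-linear automorphisms f of E that stabilize the set ⟨ξ⟩ = {ξ^i : i ∈ ℤ} (i.e., f(⟨ξ⟩) = ⟨ξ⟩) has cardinality strictly greater than n·m. (Lemma 4.1, lem_C2para / Example 3.5, exa_imp: under these conditions the non-degenerate irreducible cyclic code of length n over K, whose permutation automorphism group is isomorphic to this stabilizer, is non-standard, since its standard automorphisms form a subgroup of order exactly n·m.) -/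
open IntermediateField in
theorem orderOf_dvd_card_pow_sub_one_iff {K E : Type*} [Field K] [Fintype K] [Field E]
    [Algebra K E] [FiniteDimensional K E] {y : E} (hy : y ≠ 0) (i : ℕ) :
    orderOf y ∣ Fintype.card K ^ i - 1 ↔ Module.finrank K K⟮y⟯ ∣ i := by
  have : Finite K⟮y⟯ := Module.finite_of_finite K
  rw [← FiniteField.orderOf_frobeniusAlgHom K K⟮y⟯, orderOf_dvd_iff_pow_eq_one,
    orderOf_dvd_iff_pow_eq_one]
  have hpow : ∀ z : K⟮y⟯, (FiniteField.frobeniusAlgHom K K⟮y⟯ ^ i) z = z ^ Fintype.card K ^ i := by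
    intro z
    induction i with
    | zero => simp
    | succ i ih =>
      rw [pow_succ', AlgHom.mul_apply, ih, FiniteField.coe_frobeniusAlgHom, pow_succ, pow_mul]
  have hq : y ^ Fintype.card K ^ i = y ^ (Fintype.card K ^ i - 1) * y := by
    rw [← pow_succ, Nat.sub_add_cancel (Nat.one_le_pow _ _ Fintype.card_pos)]
  have hiff : y ^ (Fintype.card K ^ i - 1) = 1 ↔ y ^ Fintype.card K ^ i = y := by
    rw [hq, mul_eq_right₀ hy]
  rw [hiff]
  constructor
  · intro h
    refine algHom_ext_of_eq_adjoin K (S := K⟮y⟯) rfl ?_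
    rintro x hx
    obtain rfl : x = y := hx
    rw [hpow]
    exact Subtype.ext h
  · intro h
    have := hpow (AdjoinSimple.gen K y)
    rw [h] at this
    exact (congrArg Subtype.val this).symm

open IntermediateField in
theorem finrank_adjoin_simple_eq_multOrd {K E : Type*} [Field K] [Fintype K] [Field E]
    [Algebra K E] [FiniteDimensional K E] {y : E} (hy : y ≠ 0) :
    Module.finrank K K⟮y⟯ = multOrd (Fintype.card K) (orderOf y) := by
  simp only [multOrd, orderOf_dvd_card_pow_sub_one_iff hy]
  have hmem : Module.finrank K K⟮y⟯ ∈ {i : ℕ | 0 < i ∧ Module.finrank K K⟮y⟯ ∣ i} :=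
    ⟨Module.finrank_pos, dvd_rfl⟩
  have h := Nat.sInf_mem ⟨_, hmem⟩
  exact le_antisymm (Nat.le_of_dvd h.1 h.2) (Nat.sInf_le hmem)

open IntermediateField in
/-- If `K(x) = E` has degree `k` over `K(x ^ k)`, then for every `c ∈ K(x ^ k)ˣ` there is a
`K`-linear automorphism of `E` scaling `x ^ (k * a + 1)` by `c` and fixing the other powers
of `x`. -/
theorem exists_linearEquiv_scale_pow {K E : Type*} [Field K] [Field E] [Algebra K E]
    [FiniteDimensional K E] {x : E} {k : ℕ} (hx : x ≠ 0) (hk : 0 < k) (htop : K⟮x⟯ = ⊤)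
    (hfin : k * Module.finrank K K⟮x ^ k⟯ = Module.finrank K E) :
    ∃ g : E ≃ₗ[K] E, ∀ a b : ℕ, b < k →
      g (x ^ (k * a + b)) = (if b = 1 then x ^ k else 1) * x ^ (k * a + b) := by
  set F := K⟮x ^ k⟯
  have hFE : Module.finrank F E = k := by
    have h := Module.finrank_mul_finrank K F E
    rw [← hfin, mul_comm] at h
    exact Nat.eq_of_mul_eq_mul_right Module.finrank_pos h
  have htopF : F⟮x⟯ = ⊤ := by
    have h : K⟮x⟯ ≤ F⟮x⟯.restrictScalars K :=
      adjoin_simple_le_iff.2 (mem_adjoin_simple_self F x)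
    rw [htop] at h
    exact eq_top_iff.2 fun z _ => h (mem_top (x := z))
  have hdeg : (minpoly F x).natDegree = k := by
    rw [(Field.primitive_element_iff_minpoly_natDegree_eq F x).1 htopF, hFE]
  have hli := linearIndependent_pow (K := F) x
  rw [hdeg] at hli
  have : Nonempty (Fin k) := ⟨⟨0, hk⟩⟩
  let B := basisOfLinearIndependentOfCardEqFinrank hli (by simp [hFE])
  have hB : ∀ i : Fin k, B i = x ^ (i : ℕ) := fun i => by
    simp [B]
  let c : F := ⟨x ^ k, mem_adjoin_simple_self K _⟩
  have hc : c ≠ 0 := fun h => pow_ne_zero k hx (congrArg Subtype.val h)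
  let w : Fin k → Fˣ := fun i => if (i : ℕ) = 1 then Units.mk0 c hc else 1
  let g : E ≃ₗ[F] E := B.equiv (B.unitsSMul w) (Equiv.refl _)
  have hg : ∀ b < k, g (x ^ b) = (if b = 1 then x ^ k else 1) * x ^ b := by
    intro b hb
    have h := B.equiv_apply ⟨b, hb⟩ (B.unitsSMul w) (Equiv.refl _)
    rw [Equiv.refl_apply, Module.Basis.unitsSMul_apply, hB] at h
    refine h.trans ?_
    by_cases h1 : b = 1
    · simp only [w, h1, if_true]; rfl
    · simp only [w, h1, if_false, one_smul, one_mul]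
  refine ⟨g.restrictScalars K, fun a b hb => ?_⟩
  have hsplit : x ^ (k * a + b) = c ^ a • x ^ b := by
    rw [pow_add, pow_mul]; rfl
  rw [LinearEquiv.restrictScalars_apply, hsplit, map_smul, hg b hb, mul_smul_comm]

theorem image_powers_eq_of_mapsTo {E : Type*} [Monoid E] [Finite E] {x : E} {f : E → E}
    (hf : Function.Injective f) (h : ∀ i : ℕ, ∃ j : ℕ, f (x ^ i) = x ^ j) :
    f '' {y : E | ∃ i : ℕ, y = x ^ i} = {y : E | ∃ i : ℕ, y = x ^ i} := by
  refine Set.eq_of_subset_of_ncard_le ?_ (Set.ncard_image_of_injective _ hf).ge (Set.toFinite _)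
  rintro _ ⟨_, ⟨i, rfl⟩, rfl⟩
  exact h i

/-- The map `y ↦ x ^ i * σ y`, as a `K`-linear automorphism. -/
noncomputable def powMulAlgEquiv {K E : Type*} [Field K] [Field E] [Algebra K E] {x : E}
    (hx : x ≠ 0) (i : ℕ) (σ : E ≃ₐ[K] E) : E ≃ₗ[K] E :=
  σ.toLinearEquiv.trans (LinearEquiv.smulOfNeZero E E (x ^ i) (pow_ne_zero i hx) |>.restrictScalars K)

theorem powMulAlgEquiv_apply {K E : Type*} [Field K] [Field E] [Algebra K E] {x : E}
    (hx : x ≠ 0) (i : ℕ) (σ : E ≃ₐ[K] E) (y : E) :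
    powMulAlgEquiv hx i σ y = x ^ i * σ y := rfl

/-- Lemma 4.1, lem_C2para / Example 3.5, exa_imp: let `K` be a
finite field with `q` elements, `E` a degree-`m` extension of `K`, and
`ξ ∈ E` of multiplicative order `n = n'·k` with `k ≥ 2`, `n' ≥ 2`, `n ≥ 6`,
`m = ord_n(q)` and `m = k·m'` where `m' = ord_{n'}(q)`. Then the group of
`K`-linear automorphisms of `E` stabilizing the set `⟨ξ⟩ = {ξ^i}` has
cardinality strictly greater than `n·m`, i.e. the corresponding irreducible
cyclic code is non-standard. -/
theorem stmt17 (K E : Type*) [Field K] [Fintype K] [Field E] [Algebra K E]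
    [FiniteDimensional K E] (q n n' k m m' : ℕ)
    (hq : q = Fintype.card K) (hm : m = Module.finrank K E)
    (ξ : E) (hξ : orderOf ξ = n) (hnk : n = n' * k) (hk : 2 ≤ k)
    (hn' : 2 ≤ n') (hn6 : 6 ≤ n) (hmo : m = multOrd q n)
    (hm' : m' = multOrd q n') (hkm : m = k * m') :
    n * m < Nat.card
      {g : E ≃ₗ[K] E //
        (fun x => g x) '' {x : E | ∃ i : ℕ, x = ξ ^ i} =
          {x : E | ∃ i : ℕ, x = ξ ^ i}} := by
  subst hq hm hξ
  have hE : Finite E := Module.finite_of_finite K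
  have hx : ξ ≠ 0 := by
    rintro rfl
    rw [orderOf_zero] at hn6
    omega
  have hηo : orderOf (ξ ^ k) = n' := by
    rw [orderOf_pow_of_dvd (by omega) (hnk ▸ dvd_mul_left k n'), hnk,
      Nat.mul_div_cancel _ (by omega)]
  have htop : IntermediateField.adjoin K {ξ} = ⊤ := by
    refine IntermediateField.eq_of_le_of_finrank_le le_top ?_
    rw [IntermediateField.finrank_top', finrank_adjoin_simple_eq_multOrd hx, ← hmo]
  have hfin : k * Module.finrank K (IntermediateField.adjoin K {ξ ^ k}) = Module.finrank K E := by
    rw [finrank_adjoin_simple_eq_multOrd (pow_ne_zero k hx), hηo, ← hm', hkm]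
  obtain ⟨g, hg⟩ := exists_linearEquiv_scale_pow hx (by omega) htop hfin
  have hgS : (fun x => g x) '' {x : E | ∃ i : ℕ, x = ξ ^ i} = {x : E | ∃ i : ℕ, x = ξ ^ i} := by
    refine image_powers_eq_of_mapsTo g.injective fun i => ?_
    have h := hg (i / k) (i % k) (Nat.mod_lt _ (by omega))
    rw [Nat.div_add_mod] at h
    rw [h]
    split_ifs
    · exact ⟨k + i, (pow_add ξ k i).symm⟩
    · exact ⟨i, one_mul _⟩
  have hprim : IsPrimitiveRoot ξ (orderOf ξ) := IsPrimitiveRoot.orderOf ξ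
  have : NeZero (orderOf ξ) := ⟨by omega⟩
  have hstd : ∀ (i : ℕ) (σ : E ≃ₐ[K] E),
      (fun x => powMulAlgEquiv hx i σ x) '' {x : E | ∃ i : ℕ, x = ξ ^ i} =
        {x : E | ∃ i : ℕ, x = ξ ^ i} := by
    intro i σ
    obtain ⟨s, -, hs⟩ := hprim.eq_pow_of_pow_eq_one (ξ := σ ξ)
      (by rw [← map_pow, pow_orderOf_eq_one, map_one])
    refine image_powers_eq_of_mapsTo (powMulAlgEquiv hx i σ).injective fun j => ⟨i + s * j, ?_⟩
    rw [powMulAlgEquiv_apply, map_pow, ← hs, pow_add, pow_mul]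
  let Φ : Fin (orderOf ξ) × (E ≃ₐ[K] E) →
      {g : E ≃ₗ[K] E // (fun x => g x) '' {x : E | ∃ i : ℕ, x = ξ ^ i} =
        {x : E | ∃ i : ℕ, x = ξ ^ i}} :=
    fun p => ⟨powMulAlgEquiv hx p.1 p.2, hstd _ _⟩
  have hΦ : Function.Injective Φ := by
    rintro ⟨i, σ⟩ ⟨j, τ⟩ h
    have h' : ∀ y, ξ ^ (i : ℕ) * σ y = ξ ^ (j : ℕ) * τ y := fun y =>
      LinearEquiv.congr_fun (congrArg Subtype.val h) y
    have h1 : ξ ^ (i : ℕ) = ξ ^ (j : ℕ) := by simpa using h' 1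
    have hij : i = j := Fin.ext (hprim.pow_inj i.2 j.2 h1)
    subst hij
    have hστ : σ = τ := AlgEquiv.ext fun y => mul_left_cancel₀ (pow_ne_zero _ hx) (h' y)
    rw [hστ]
  have hcard : Nat.card (Fin (orderOf ξ) × (E ≃ₐ[K] E)) = orderOf ξ * Module.finrank K E := by
    rw [Nat.card_prod, Nat.card_fin, IsGalois.card_aut_eq_finrank]
  have : Finite (E ≃ₗ[K] E) := Finite.of_injective _ DFunLike.coe_injective
  by_contra! hle
  obtain ⟨⟨i, σ⟩, hp⟩ := (hΦ.bijective_of_nat_card_le (hcard ▸ hle)).2 ⟨g, hgS⟩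
  have hgσ : ∀ y, ξ ^ (i : ℕ) * σ y = g y := fun y =>
    LinearEquiv.congr_fun (congrArg Subtype.val hp) y
  have hi : ξ ^ (i : ℕ) = 1 := by
    have h := hg 0 0 (by omega)
    rw [← hgσ] at h
    simpa using h
  simp only [hi, one_mul] at hgσ
  have hσξ : σ ξ = ξ ^ k * ξ := by
    have h := hg 0 1 (by omega)
    rw [← hgσ] at h
    simpa using h
  have hfix : ∀ j : ℕ, j % k ≠ 1 → (ξ ^ k) ^ j = 1 := by
    intro j hj
    have h := hg (j / k) (j % k) (Nat.mod_lt _ (by omega))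
    rw [Nat.div_add_mod, ← hgσ, if_neg hj, one_mul, map_pow, hσξ, mul_pow] at h
    exact (mul_eq_right₀ (pow_ne_zero j hx)).1 h
  have h2 : n' ∣ 2 := hηo ▸ orderOf_dvd_of_pow_eq_one (hfix 2 (by
    rcases hk.eq_or_lt with rfl | h
    · norm_num
    · rw [Nat.mod_eq_of_lt h]; norm_num))
  obtain rfl : n' = 2 := le_antisymm (Nat.le_of_dvd two_pos h2) hn'
  have h3 : 2 ∣ 3 := hηo ▸ orderOf_dvd_of_pow_eq_one (hfix 3 (by
    rcases (show 3 ≤ k by omega).eq_or_lt with rfl | h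
    · norm_num
    · rw [Nat.mod_eq_of_lt h]; norm_num))
  omega
end
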